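/- For all integers n ≥ 4 and k with 1 ≤ k ≤ 10, √(n-2) + 2(k+1)/((n-1)√(n-2)) + 1/(2√(n-2)) > √(n-1) + 2(k+1)/(n√(n-1)). -/

import Mathlib

theorem stmt_15 (n k : ℤ) (hn : 4 ≤ n) (hk1 : 1 ≤ k) (hk2 : k ≤ 10) :
    Real.sqrt ((n:ℝ) - 2) + 2*((k:ℝ) + 1)/(((n:ℝ) - 1)*Real.sqrt ((n:ℝ) - 2))
      + 1/(2*Real.sqrt ((n:ℝ) - 2)) >
    Real.sqrt ((n:ℝ) - 1) + 2*((k:ℝ) + 1)/((n:ℝ)*Real.sqrt ((n:ℝ) - 1)) := by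
  have hn' : (4:ℝ) ≤ n := by exact_mod_cast hn
  have hk' : (1:ℝ) ≤ k := by exact_mod_cast hk1
  have ha : 0 < Real.sqrt ((n:ℝ) - 2) := Real.sqrt_pos.mpr (by linarith)
  have hab : Real.sqrt ((n:ℝ) - 2) ≤ Real.sqrt ((n:ℝ) - 1) :=
    Real.sqrt_le_sqrt (by linarith)
  have ha2 : Real.sqrt ((n:ℝ) - 2) ^ 2 = n - 2 := Real.sq_sqrt (by linarith)
  have h1 : Real.sqrt ((n:ℝ) - 1) ≤ Real.sqrt ((n:ℝ) - 2) + 1/(2*Real.sqrt ((n:ℝ) - 2)) := by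
    apply Real.sqrt_le_iff.mpr
    refine ⟨by positivity, ?_⟩
    have e : (Real.sqrt ((n:ℝ) - 2) + 1/(2*Real.sqrt ((n:ℝ) - 2)))^2
        = Real.sqrt ((n:ℝ) - 2) ^ 2 + 1 + (1/(2*Real.sqrt ((n:ℝ) - 2)))^2 := by
      field_simp
      ring
    rw [e, ha2]
    have := sq_nonneg (1/(2*Real.sqrt ((n:ℝ) - 2)))
    linarith
  have h2 : 2*((k:ℝ) + 1)/((n:ℝ)*Real.sqrt ((n:ℝ) - 1))
      < 2*((k:ℝ) + 1)/(((n:ℝ) - 1)*Real.sqrt ((n:ℝ) - 2)) := by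
    apply div_lt_div_of_pos_left (by linarith) (mul_pos (by linarith) ha)
    nlinarith
  linarith
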